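/- For every natural number a ≥ 2 there exist natural numbers a₁, a₂ with a₁ + a₂ + 1 = a such that at least one of the following holds (where the characteristic functions are evaluated at the images of a₁, a₂, a in ZMod 10): (i) χ₂(a₁)·χ₂(a₂) = -χ₁(a); (ii) a₁ = 0, (a₂ : ZMod 10) = 1, and χ₁(a) = 1; (iii) a₁ = 0, (a₂ : ZMod 10) = 6, and χ₁(a) = -1. -/

import Mathlib

/-- The characteristic function χ₁ : ZMod 10 → ℤ. -/
def chi1 (x : ZMod 10) : ℤ :=
  if x ∈ ({0, 2, 3, 6, 9} : Finset (ZMod 10)) then 1 else -1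

/-- The characteristic function χ₂ : ZMod 10 → ℤ. -/
def chi2 (x : ZMod 10) : ℤ :=
  if x ∈ ({0, 3, 7} : Finset (ZMod 10)) then 1
  else if x ∈ ({2, 5, 8} : Finset (ZMod 10)) then -1
  else 0

theorem cast_residue (j k : ℕ) : ((10 * k + j : ℕ) : ZMod 10) = (j : ZMod 10) := by
  have h : (10 : ZMod 10) = 0 := by decide
  push_cast
  rw [h, zero_mul, zero_add]

/-- The splitting can be chosen from the residue of `a` alone. -/
theorem split_of_residue (a b r s c : ℕ) (hr : a % 10 = r) (hs : b % 10 = s)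
    (hsum : c + b + 1 = a)
    (h : chi2 (c : ZMod 10) * chi2 (s : ZMod 10) = -chi1 (r : ZMod 10) ∨
        (c = 0 ∧ (s : ZMod 10) = 1 ∧ chi1 (r : ZMod 10) = 1) ∨
        (c = 0 ∧ (s : ZMod 10) = 6 ∧ chi1 (r : ZMod 10) = -1)) :
    ∃ a₁ a₂ : ℕ, a₁ + a₂ + 1 = a ∧
      (chi2 (a₁ : ZMod 10) * chi2 (a₂ : ZMod 10) = -chi1 (a : ZMod 10) ∨
        (a₁ = 0 ∧ (a₂ : ZMod 10) = 1 ∧ chi1 (a : ZMod 10) = 1) ∨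
        (a₁ = 0 ∧ (a₂ : ZMod 10) = 6 ∧ chi1 (a : ZMod 10) = -1)) := by
  have ea : (a : ZMod 10) = (r : ZMod 10) := by
    rw [← cast_residue r (a / 10), ← hr, Nat.div_add_mod]
  have eb : (b : ZMod 10) = (s : ZMod 10) := by
    rw [← cast_residue s (b / 10), ← hs, Nat.div_add_mod]
  refine ⟨c, b, hsum, ?_⟩
  rw [ea, eb]
  exact h

theorem stmt_18 (a : ℕ) (ha : 2 ≤ a) :
    ∃ a₁ a₂ : ℕ, a₁ + a₂ + 1 = a ∧
      (chi2 (a₁ : ZMod 10) * chi2 (a₂ : ZMod 10) = -chi1 (a : ZMod 10) ∨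
        (a₁ = 0 ∧ (a₂ : ZMod 10) = 1 ∧ chi1 (a : ZMod 10) = 1) ∨
        (a₁ = 0 ∧ (a₂ : ZMod 10) = 6 ∧ chi1 (a : ZMod 10) = -1)) := by
  have hlt : a % 10 < 10 := Nat.mod_lt _ (by norm_num)
  generalize hr : a % 10 = r at hlt
  interval_cases r
  · exact split_of_residue a (a - 3) 0 7 2 hr (by omega) (by omega) (by decide)
  · exact split_of_residue a (a - 1) 1 0 0 hr (by omega) (by omega) (by decide)
  · exact split_of_residue a (a - 1) 2 1 0 hr (by omega) (by omega) (by decide)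
  · exact split_of_residue a (a - 1) 3 2 0 hr (by omega) (by omega) (by decide)
  · exact split_of_residue a (a - 1) 4 3 0 hr (by omega) (by omega) (by decide)
  · exact split_of_residue a (a - 3) 5 2 2 hr (by omega) (by omega) (by decide)
  · exact split_of_residue a (a - 1) 6 5 0 hr (by omega) (by omega) (by decide)
  · exact split_of_residue a (a - 1) 7 6 0 hr (by omega) (by omega) (by decide)
  · exact split_of_residue a (a - 1) 8 7 0 hr (by omega) (by omega) (by decide)
  · exact split_of_residue a (a - 1) 9 8 0 hr (by omega) (by omega) (by decide)
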